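/- The function F(a) := ∫₀^a √(log(e + 1/z)) dz is finite for every a ≥ 0, is concave on [0, ∞), and there exists a constant c > 0 such that F(a) ≤ c · a · √(log(e + 1/a)) for all a > 0. -/

import Mathlib

open MeasureTheory

/-- The primitive of a function that is continuous, antitone and locally integrable on the positive
half-line is concave. -/
theorem concaveOn_integral_of_antitoneOn {f : ℝ → ℝ} (hc : ContinuousOn f (Set.Ioi 0))
    (ha : AntitoneOn f (Set.Ioi 0)) (hi : ∀ a : ℝ, 0 ≤ a → IntervalIntegrable f volume 0 a) :
    ConcaveOn ℝ (Set.Ici 0) (fun a : ℝ => ∫ z in (0 : ℝ)..a, f z) := by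
  have hd : ∀ x ∈ Set.Ioi (0 : ℝ), HasDerivAt (fun a : ℝ => ∫ z in (0 : ℝ)..a, f z) (f x) x :=
    fun x hx => intervalIntegral.integral_hasDerivAt_right (hi x (le_of_lt hx))
      (hc.stronglyMeasurableAtFilter isOpen_Ioi x hx) (hc.continuousAt (Ioi_mem_nhds hx))
  refine AntitoneOn.concaveOn_of_deriv (convex_Ici 0) ?_ ?_ ?_
  · intro x hx
    have hx' : (0 : ℝ) ≤ x + 1 := add_nonneg hx zero_le_one
    have h := intervalIntegral.continuousOn_primitive_interval'
      (hi (x + 1) hx') Set.left_mem_uIcc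
    rw [Set.uIcc_of_le hx'] at h
    refine (h x ⟨hx, by linarith⟩).mono_of_mem_nhdsWithin ?_
    rw [← Set.Ici_inter_Iic]
    exact Filter.inter_mem self_mem_nhdsWithin
      (mem_nhdsWithin_of_mem_nhds (Iic_mem_nhds (by linarith)))
  · rw [interior_Ici]
    exact fun x hx => (hd x hx).differentiableAt.differentiableWithinAt
  · rw [interior_Ici]
    exact ha.congr fun x hx => (hd x hx).deriv.symm

theorem one_le_log_exp_one_add_inv {z : ℝ} (hz : 0 < z) :
    1 ≤ Real.log (Real.exp 1 + 1 / z) := by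
  have h : 0 < 1 / z := by positivity
  rw [Real.le_log_iff_exp_le (by positivity)]
  linarith

theorem continuousOn_sqrt_log_exp_one_add_inv :
    ContinuousOn (fun z : ℝ => Real.sqrt (Real.log (Real.exp 1 + 1 / z))) (Set.Ioi 0) := by
  refine (ContinuousOn.log (continuousOn_const.add
    (continuousOn_const.div continuousOn_id fun z hz => ne_of_gt hz)) fun z hz => ?_).sqrt
  have : (0 : ℝ) < z := hz
  exact (show (0 : ℝ) < Real.exp 1 + 1 / z by positivity).ne'

theorem antitoneOn_sqrt_log_exp_one_add_inv :
    AntitoneOn (fun z : ℝ => Real.sqrt (Real.log (Real.exp 1 + 1 / z))) (Set.Ioi 0) := by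
  intro x hx y hy hxy
  have hx : (0 : ℝ) < x := hx
  have hy : (0 : ℝ) < y := hy
  exact Real.sqrt_le_sqrt (Real.log_le_log (by positivity) (by gcongr))

theorem log_exp_one_add_inv_le {a z : ℝ} (hz : 0 < z) (hza : z ≤ a) :
    Real.log (Real.exp 1 + 1 / z) ≤ Real.log (Real.exp 1 + 1 / a) * (a / z) := by
  have ha : 0 < a := hz.trans_le hza
  have hL := one_le_log_exp_one_add_inv ha
  have ht : 1 ≤ a / z := (one_le_div hz).2 hza
  have hle : Real.exp 1 + 1 / z ≤ (Real.exp 1 + 1 / a) * (a / z) := by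
    have h : 1 / a * (a / z) = 1 / z := by field_simp
    rw [add_mul, h]
    nlinarith [Real.exp_pos 1]
  calc Real.log (Real.exp 1 + 1 / z)
      ≤ Real.log ((Real.exp 1 + 1 / a) * (a / z)) := Real.log_le_log (by positivity) hle
    _ = Real.log (Real.exp 1 + 1 / a) + Real.log (a / z) :=
        Real.log_mul (by positivity) (by positivity)
    _ ≤ Real.log (Real.exp 1 + 1 / a) * (a / z) := by
        nlinarith [Real.log_le_sub_one_of_pos (show 0 < a / z by positivity)]

theorem sqrt_log_exp_one_add_inv_le {a z : ℝ} (hz : 0 < z) (hza : z ≤ a) :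
    Real.sqrt (Real.log (Real.exp 1 + 1 / z)) ≤
      Real.sqrt (Real.log (Real.exp 1 + 1 / a)) * Real.sqrt a * z ^ (-(1 / 2) : ℝ) := by
  have ha : 0 < a := hz.trans_le hza
  have hL := one_le_log_exp_one_add_inv ha
  refine (Real.sqrt_le_sqrt (log_exp_one_add_inv_le hz hza)).trans_eq ?_
  rw [Real.sqrt_mul (by linarith), Real.sqrt_div ha.le, Real.rpow_neg hz.le,
    ← Real.sqrt_eq_rpow, mul_assoc, div_eq_mul_inv (Real.sqrt a)]

theorem intervalIntegrable_sqrt_log_exp_one_add_inv {a : ℝ} (ha : 0 ≤ a) :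
    IntervalIntegrable (fun z : ℝ => Real.sqrt (Real.log (Real.exp 1 + 1 / z))) volume 0 a := by
  have hg : IntervalIntegrable (fun z : ℝ => Real.sqrt (Real.log (Real.exp 1 + 1 / a)) *
      Real.sqrt a * z ^ (-(1 / 2) : ℝ)) volume 0 a :=
    (intervalIntegral.intervalIntegrable_rpow' (by norm_num)).const_mul _
  rw [intervalIntegrable_iff_integrableOn_Ioc_of_le ha] at hg ⊢
  refine hg.mono' ((continuousOn_sqrt_log_exp_one_add_inv.mono
    Set.Ioc_subset_Ioi_self).aestronglyMeasurable measurableSet_Ioc) ?_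
  filter_upwards [ae_restrict_mem measurableSet_Ioc] with z hz
  rw [Real.norm_of_nonneg (Real.sqrt_nonneg _)]
  exact sqrt_log_exp_one_add_inv_le hz.1 hz.2

theorem integral_sqrt_log_exp_one_add_inv_le {a : ℝ} (ha : 0 < a) :
    (∫ z in (0 : ℝ)..a, Real.sqrt (Real.log (Real.exp 1 + 1 / z)))
      ≤ 2 * a * Real.sqrt (Real.log (Real.exp 1 + 1 / a)) := by
  have hmono := intervalIntegral.integral_mono_on_of_le_Ioo ha.le
    (intervalIntegrable_sqrt_log_exp_one_add_inv ha.le)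
    ((intervalIntegral.intervalIntegrable_rpow' (by norm_num)).const_mul
      (Real.sqrt (Real.log (Real.exp 1 + 1 / a)) * Real.sqrt a))
    fun z hz => sqrt_log_exp_one_add_inv_le hz.1 hz.2.le
  refine hmono.trans_eq ?_
  have hexp : (-(1 / 2) + 1 : ℝ) = 1 / 2 := by norm_num
  rw [intervalIntegral.integral_const_mul, integral_rpow (Or.inl (by norm_num)), hexp,
    Real.zero_rpow (by norm_num), ← Real.sqrt_eq_rpow]
  linear_combination 2 * Real.sqrt (Real.log (Real.exp 1 + 1 / a)) * Real.mul_self_sqrt ha.le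

/-- The function `F(a) := ∫₀ᵃ √(log(e + 1/z)) dz` is finite (the integrand is
integrable on `(0, a]`) for every `a ≥ 0`, is concave on `[0,∞)`, and there is `c > 0` with
`F(a) ≤ c a √(log(e + 1/a))` for all `a > 0`. -/
theorem stmt18 :
    (∀ a : ℝ, 0 ≤ a →
      IntegrableOn (fun z : ℝ => Real.sqrt (Real.log (Real.exp 1 + 1 / z))) (Set.Ioc 0 a)) ∧
    ConcaveOn ℝ (Set.Ici 0)
      (fun a : ℝ => ∫ z in (0 : ℝ)..a, Real.sqrt (Real.log (Real.exp 1 + 1 / z))) ∧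
    ∃ c : ℝ, 0 < c ∧ ∀ a : ℝ, 0 < a →
      (∫ z in (0 : ℝ)..a, Real.sqrt (Real.log (Real.exp 1 + 1 / z)))
        ≤ c * a * Real.sqrt (Real.log (Real.exp 1 + 1 / a)) := by
  refine ⟨fun a ha => ?_, ?_, 2, two_pos, fun a ha => integral_sqrt_log_exp_one_add_inv_le ha⟩
  · exact (intervalIntegrable_iff_integrableOn_Ioc_of_le ha).1
      (intervalIntegrable_sqrt_log_exp_one_add_inv ha)
  · exact concaveOn_integral_of_antitoneOn continuousOn_sqrt_log_exp_one_add_inv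
      antitoneOn_sqrt_log_exp_one_add_inv
      fun a ha => intervalIntegrable_sqrt_log_exp_one_add_inv ha
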